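/- (Euler transformation.) Let α, β, γ be multiplicative characters of κ with α ≠ ε, α ≠ γ, β ≠ ε and β ≠ γ. Then for every λ ∈ κ with λ ≠ 1: F(α,β; γ; λ) = (ᾱβ̄γ)(1−λ) · F(ᾱγ, β̄γ; γ; λ). -/

import Mathlib

/-!
Finite-field hypergeometric functions (Otsubo), basic definitions:
`κ` is a finite field with `q = Fintype.card κ` elements, `ψ` a fixed nontrivial
additive character, multiplicative characters are `MulChar κ ℂ` (extended by `0`
on `0`, with trivial character `1`).
-/

open scoped Classical

noncomputable section

variable {κ : Type*} [Field κ] [Fintype κ]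

instance : Fintype (MulChar κ ℂ) := Fintype.ofFinite _

/-- The Gauss sum `g(φ) = -∑_{x ∈ κ} ψ(x) φ(x)`. -/
def gS (ψ : AddChar κ ℂ) (φ : MulChar κ ℂ) : ℂ := -∑ x : κ, ψ x * φ x

/-- The variant `g°(φ) = q^{δ(φ)} · g(φ)`, where `δ(φ) = 1` iff `φ` is trivial. -/
def gSo (ψ : AddChar κ ℂ) (φ : MulChar κ ℂ) : ℂ :=
  (if φ = 1 then (Fintype.card κ : ℂ) else 1) * gS ψ φ

/-- The Pochhammer symbol `(α)_ν = g(αν)/g(α)`. -/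
def poch (ψ : AddChar κ ℂ) (α ν : MulChar κ ℂ) : ℂ := gS ψ (α * ν) / gS ψ α

/-- The variant Pochhammer symbol `(α)°_ν = g°(αν)/g°(α)`. -/
def pocho (ψ : AddChar κ ℂ) (α ν : MulChar κ ℂ) : ℂ := gSo ψ (α * ν) / gSo ψ α

/-- The finite hypergeometric function
`F(α₁,…,α_r; β₁,…,β_s; λ) = (1/(1-q)) ∑_ν ((α₁)_ν ⋯ (α_r)_ν / ((ε)°_ν (β₁)°_ν ⋯ (β_s)°_ν)) ν(λ)`
(the trivial character `ε = 1` appears implicitly among the lower parameters). -/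
def Fh (ψ : AddChar κ ℂ) {r s : ℕ} (A : Fin r → MulChar κ ℂ) (B : Fin s → MulChar κ ℂ)
    (l : κ) : ℂ :=
  (1 - (Fintype.card κ : ℂ))⁻¹ *
    ∑ ν : MulChar κ ℂ,
      ((∏ i, poch ψ (A i) ν) / (pocho ψ 1 ν * ∏ j, pocho ψ (B j) ν)) * ν l

theorem gS_eq_neg_gaussSum (ψ : AddChar κ ℂ) (χ : MulChar κ ℂ) : gS ψ χ = -gaussSum χ ψ := by
  simp only [gS, gaussSum, mul_comm]

theorem gS_one {ψ : AddChar κ ℂ} (hψ : ψ ≠ 1) : gS ψ 1 = 1 := by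
  rw [gS_eq_neg_gaussSum, gaussSum_one_left hψ, neg_neg]

theorem card_ne_zero_complex : (Fintype.card κ : ℂ) ≠ 0 :=
  Nat.cast_ne_zero.mpr Fintype.card_ne_zero

theorem gS_ne_zero {ψ : AddChar κ ℂ} (hψ : ψ ≠ 1) (χ : MulChar κ ℂ) : gS ψ χ ≠ 0 := by
  rcases eq_or_ne χ 1 with rfl | hχ
  · simp [gS_one hψ]
  · rw [gS_eq_neg_gaussSum]
    exact neg_ne_zero.mpr (gaussSum_ne_zero_of_nontrivial card_ne_zero_complex hχ
      (AddChar.IsPrimitive.of_ne_one hψ))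

theorem gSo_ne_zero {ψ : AddChar κ ℂ} (hψ : ψ ≠ 1) (χ : MulChar κ ℂ) : gSo ψ χ ≠ 0 := by
  rw [gSo]
  refine mul_ne_zero ?_ (gS_ne_zero hψ χ)
  split_ifs
  exacts [card_ne_zero_complex, one_ne_zero]

theorem gSo_one {ψ : AddChar κ ℂ} (hψ : ψ ≠ 1) : gSo ψ 1 = Fintype.card κ := by
  simp [gSo, gS_one hψ]

theorem MulChar.apply_neg_one_mul_self {R : Type*} [CommRing R] (χ : MulChar R ℂ) : χ (-1) * χ (-1) = 1 := by
  rw [← map_mul, neg_one_mul, neg_neg, map_one]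

/-- The reflection formula for Gauss sums. -/
theorem gS_mul_gS_inv {ψ : AddChar κ ℂ} (hψ : ψ ≠ 1) {χ : MulChar κ ℂ} (hχ : χ ≠ 1) :
    gS ψ χ * gS ψ χ⁻¹ = χ (-1) * Fintype.card κ := by
  have h := gaussSum_mul_gaussSum_eq_card hχ (AddChar.IsPrimitive.of_ne_one hψ)
  have h2 := mul_gaussSum_inv_eq_gaussSum χ⁻¹ ψ
  rw [MulChar.inv_apply', inv_neg_one] at h2
  rw [gS_eq_neg_gaussSum, gS_eq_neg_gaussSum, ← h2, ← h]
  ring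

/-- Jacobi sums in terms of Gauss sums, including the case where `χ * φ` is trivial. -/
theorem gS_mul_gS {ψ : AddChar κ ℂ} (hψ : ψ ≠ 1) (χ : MulChar κ ℂ) {φ : MulChar κ ℂ}
    (hφ : φ ≠ 1) : gS ψ χ * gS ψ φ = -(gSo ψ (χ * φ) * jacobiSum χ φ) := by
  by_cases h : χ * φ = 1
  · obtain rfl : φ = χ⁻¹ := eq_inv_of_mul_eq_one_right h
    have hχ : χ ≠ 1 := fun h1 => hφ (by rw [h1, inv_one])
    rw [gS_mul_gS_inv hψ hχ, h, gSo_one hψ, jacobiSum_nontrivial_inv hχ]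
    ring
  · rw [gSo, if_neg h, one_mul, gS_eq_neg_gaussSum, gS_eq_neg_gaussSum, gS_eq_neg_gaussSum,
      neg_mul_neg, ← jacobiSum_mul_nontrivial h ψ]
    ring

theorem poch_div_pocho {ψ : AddChar κ ℂ} (hψ : ψ ≠ 1) {β γ : MulChar κ ℂ} (hβγ : β ≠ γ)
    (ν : MulChar κ ℂ) :
    poch ψ β ν / pocho ψ γ ν =
      -(gSo ψ γ / (gS ψ β * gS ψ (β⁻¹ * γ))) * jacobiSum (β * ν) (β⁻¹ * γ) := by
  have hφ : β⁻¹ * γ ≠ 1 := fun h => hβγ (inv_mul_eq_one.mp h)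
  have h := gS_mul_gS hψ (β * ν) hφ
  rw [show β * ν * (β⁻¹ * γ) = γ * ν by rw [mul_comm β ν, mul_assoc, mul_inv_cancel_left,
    mul_comm]] at h
  have h1 := gS_ne_zero hψ β
  have h2 := gS_ne_zero hψ (β⁻¹ * γ)
  have h3 := gSo_ne_zero hψ γ
  have h4 := gSo_ne_zero hψ (γ * ν)
  rw [poch, pocho]
  field_simp
  linear_combination h

theorem poch_div_pocho_one {ψ : AddChar κ ℂ} (hψ : ψ ≠ 1) {α : MulChar κ ℂ} (hα : α ≠ 1)
    (ν : MulChar κ ℂ) :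
    poch ψ α ν / pocho ψ 1 ν = -α (-1) * jacobiSum (α * ν) α⁻¹ := by
  have hq := card_ne_zero_complex (κ := κ)
  have hs := α.apply_neg_one_mul_self
  have h0 : α (-1) ≠ 0 := left_ne_zero_of_mul_eq_one hs
  rw [poch_div_pocho hψ hα, mul_one, gS_mul_gS_inv hψ hα, gSo_one hψ]
  congr 2
  field_simp
  linear_combination -hs

theorem MulChar.sum_apply_eq_ite (a : κ) :
    ∑ χ : MulChar κ ℂ, χ a = if a = 1 then (Fintype.card κ : ℂ) - 1 else 0 := by
  split_ifs with ha
  · subst ha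
    have h := MulChar.card_eq_card_units_of_hasEnoughRootsOfUnity κ ℂ
    rw [Nat.card_eq_fintype_card, Nat.card_eq_fintype_card, Fintype.card_units] at h
    simp [h, Nat.cast_sub Fintype.card_pos]
  · obtain ⟨χ, hχ⟩ := MulChar.exists_apply_ne_one_of_hasEnoughRootsOfUnity κ ℂ ha
    refine eq_zero_of_mul_eq_self_left hχ ?_
    simp only [Finset.mul_sum, ← MulChar.mul_apply]
    exact Fintype.sum_bijective _ (Group.mulLeft_bijective χ) _ _ fun _ ↦ rfl

/-- The character sum that plays the role of Euler's integral for `₂F₁`. -/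
def eulerSum (α β φ : MulChar κ ℂ) (l : κ) : ℂ :=
  ∑ t : κ, β t * φ (1 - t) * α⁻¹ (1 - l * t)

theorem sum_jacobiSum_mul_jacobiSum (α β φ : MulChar κ ℂ) {l : κ} (hl : l ≠ 0) :
    ∑ ν : MulChar κ ℂ, jacobiSum (α * ν) α⁻¹ * jacobiSum (β * ν) φ * ν l =
      (Fintype.card κ - 1) * α (-1) * eulerSum α β φ l := by
  have h1 (ν : MulChar κ ℂ) : jacobiSum (α * ν) α⁻¹ * jacobiSum (β * ν) φ * ν l =
      ∑ t : κ, ∑ s : κ, β t * φ (1 - t) * (α s * α⁻¹ (1 - s)) * ν (l * t * s) := by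
    rw [mul_comm (jacobiSum _ _), jacobiSum, jacobiSum, Finset.sum_mul_sum, Finset.sum_mul]
    refine Finset.sum_congr rfl fun t _ => ?_
    rw [Finset.sum_mul]
    refine Finset.sum_congr rfl fun s _ => ?_
    rw [MulChar.mul_apply, MulChar.mul_apply, map_mul, map_mul]
    ring
  simp_rw [h1]
  rw [Finset.sum_comm, eulerSum, Finset.mul_sum]
  refine Finset.sum_congr rfl fun t _ => ?_
  rw [Finset.sum_comm]
  simp_rw [← Finset.mul_sum, MulChar.sum_apply_eq_ite]
  rcases eq_or_ne t 0 with rfl | ht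
  · simp [MulChar.map_zero]
  have hlt : l * t ≠ 0 := mul_ne_zero hl ht
  have h2 (s : κ) : l * t * s = 1 ↔ s = (l * t)⁻¹ := by
    rw [mul_eq_one_iff_inv_eq₀ hlt, eq_comm]
  simp_rw [h2, mul_ite, mul_zero]
  rw [Finset.sum_ite_eq' Finset.univ, if_pos (Finset.mem_univ _), ← MulChar.inv_apply']
  have h3 : (α⁻¹ (l * t)) * α⁻¹ (1 - (l * t)⁻¹) = α (-1) * α⁻¹ (1 - l * t) := by
    have h4 : α (-1) = α⁻¹ (-1) := by rw [MulChar.inv_apply', inv_neg_one]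
    rw [h4, ← map_mul, ← map_mul]
    congr 1
    field_simp
    ring
  rw [h3]
  ring

theorem one_sub_card_ne_zero : (1 - (Fintype.card κ : ℂ)) ≠ 0 := by
  rw [sub_ne_zero]
  exact_mod_cast (Fintype.one_lt_card (α := κ)).ne

/-- The Euler integral representation of the finite-field `₂F₁`. -/
theorem Fh_eq_eulerSum {ψ : AddChar κ ℂ} (hψ : ψ ≠ 1) {α β γ : MulChar κ ℂ}
    (hα : α ≠ 1) (hβγ : β ≠ γ) {l : κ} (hl : l ≠ 0) :
    Fh ψ ![α, β] ![γ] l =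
      -(gSo ψ γ / (gS ψ β * gS ψ (β⁻¹ * γ))) * eulerSum α β (β⁻¹ * γ) l := by
  have h (ν : MulChar κ ℂ) :
      (∏ i, poch ψ (![α, β] i) ν) / (pocho ψ 1 ν * ∏ j, pocho ψ (![γ] j) ν) * ν l =
        α (-1) * (gSo ψ γ / (gS ψ β * gS ψ (β⁻¹ * γ))) *
          (jacobiSum (α * ν) α⁻¹ * jacobiSum (β * ν) (β⁻¹ * γ) * ν l) := by
    simp only [Fin.prod_univ_two, Fin.prod_univ_one, Matrix.cons_val_zero, Matrix.cons_val_one]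
    rw [mul_div_mul_comm, poch_div_pocho_one hψ hα, poch_div_pocho hψ hβγ]
    ring
  rw [Fh]
  simp_rw [h]
  rw [← Finset.mul_sum, sum_jacobiSum_mul_jacobiSum _ _ _ hl,
    inv_mul_eq_iff_eq_mul₀ one_sub_card_ne_zero]
  linear_combination (gSo ψ γ / (gS ψ β * gS ψ (β⁻¹ * γ))) * (Fintype.card κ - 1) *
    eulerSum α β (β⁻¹ * γ) l * α.apply_neg_one_mul_self

theorem eulerSum_pfaff (α β φ : MulChar κ ℂ) {l : κ} (hl : l ≠ 1) :
    eulerSum α β φ l = α⁻¹ (1 - l) * eulerSum α φ β (l / (l - 1)) := by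
  have hl1 : l - 1 ≠ 0 := sub_ne_zero.mpr hl
  rw [eulerSum, eulerSum, ← Equiv.sum_comp (Equiv.subLeft (1 : κ)), Finset.mul_sum]
  refine Finset.sum_congr rfl fun t _ => ?_
  have h : 1 - l * (1 - t) = (1 - l) * (1 - l / (l - 1) * t) := by
    field_simp
    ring
  rw [Equiv.subLeft_apply, h, map_mul, sub_sub_cancel]
  ring

/-- The Pfaff transformation of the finite-field `₂F₁`. -/
theorem Fh_pfaff {ψ : AddChar κ ℂ} (hψ : ψ ≠ 1) {α β γ : MulChar κ ℂ}
    (hα : α ≠ 1) (hβ : β ≠ 1) (hβγ : β ≠ γ) {l : κ} (hl : l ≠ 1) :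
    Fh ψ ![α, β] ![γ] l = α⁻¹ (1 - l) * Fh ψ ![α, β⁻¹ * γ] ![γ] (l / (l - 1)) := by
  rcases eq_or_ne l 0 with rfl | hl0
  · simp [Fh, MulChar.map_zero]
  have hl1 : l / (l - 1) ≠ 0 := div_ne_zero hl0 (sub_ne_zero.mpr hl)
  have hφγ : β⁻¹ * γ ≠ γ := fun h => hβ (inv_eq_one.mp (mul_eq_right.mp h))
  have hinv : (β⁻¹ * γ)⁻¹ * γ = β := by rw [mul_inv, inv_inv, inv_mul_cancel_right]
  rw [Fh_eq_eulerSum hψ hα hβγ hl0, Fh_eq_eulerSum hψ hα hφγ hl1, hinv,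
    eulerSum_pfaff _ _ _ hl]
  ring

theorem Fh_swap (ψ : AddChar κ ℂ) {s : ℕ} (α β : MulChar κ ℂ) (B : Fin s → MulChar κ ℂ) (l : κ) :
    Fh ψ ![α, β] B l = Fh ψ ![β, α] B l := by
  simp only [Fh, Fin.prod_univ_two, Matrix.cons_val_zero, Matrix.cons_val_one,
    mul_comm (poch ψ α _)]

/-- Euler transformation: for `α ≠ ε`, `α ≠ γ`, `β ≠ ε`, `β ≠ γ` and `λ ≠ 1`,
`F(α,β;γ;λ) = (ᾱβ̄γ)(1-λ) · F(ᾱγ,β̄γ;γ;λ)`. -/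
theorem stmt_9 (ψ : AddChar κ ℂ) (hψ : ψ ≠ 1) (α β γ : MulChar κ ℂ)
    (hα1 : α ≠ 1) (hαγ : α ≠ γ) (hβ1 : β ≠ 1) (hβγ : β ≠ γ)
    (l : κ) (hl : l ≠ 1) :
    Fh ψ ![α, β] ![γ] l =
      (α⁻¹ * β⁻¹ * γ) (1 - l) * Fh ψ ![α⁻¹ * γ, β⁻¹ * γ] ![γ] l := by
  have hl1 : l - 1 ≠ 0 := sub_ne_zero.mpr hl
  have hm : l / (l - 1) ≠ 1 := by
    rw [Ne, div_eq_one_iff_eq hl1, eq_comm, sub_eq_self]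
    exact one_ne_zero
  have hmm : l / (l - 1) / (l / (l - 1) - 1) = l := by
    have : l / (l - 1) - 1 = (l - 1)⁻¹ := by
      field_simp
      ring
    rw [this]
    field_simp
  have h1m : 1 - l / (l - 1) = (1 - l)⁻¹ := by
    have : 1 - l ≠ 0 := sub_ne_zero.mpr hl.symm
    field_simp
    ring
  have hφ : β⁻¹ * γ ≠ 1 := fun h => hβγ (inv_mul_eq_one.mp h)
  rw [Fh_pfaff hψ hα1 hβ1 hβγ hl, Fh_swap, Fh_pfaff hψ hφ hα1 hαγ hm, hmm, Fh_swap, h1m,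
    ← MulChar.inv_apply', inv_inv, ← mul_assoc, ← MulChar.mul_apply, mul_assoc α⁻¹]

end
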